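/- arXiv:2012.03064 — 7 statements merged into one kernel-verified Lean document; each statement's English description precedes it below -/
import Mathlib

section
/- Two labeled tetrahedra are strongly congruent if and only if they are congruent with equal signed volume: for points p1,…,p4 and p̂1,…,p̂4 in ℝ³, there exist R ∈ SO(3) and d ∈ ℝ³ with p̂i = R·pi + d for all i ∈ {1,2,3,4} if and only if ‖pi − pj‖ = ‖p̂i − p̂j‖ for all i, j ∈ {1,2,3,4} and V(p1,p2,p3,p4) = V(p̂1,p̂2,p̂3,p̂4). -/
open scoped RealInnerProductSpace
open Real Filter

noncomputable section

/-- Euclidean 3-space. -/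
abbrev E3 : Type := EuclideanSpace ℝ (Fin 3)

/-- The cross product on `ℝ³`. -/
def cross3 (a b : E3) : E3 :=
  (WithLp.equiv 2 (Fin 3 → ℝ)).symm
    ![a 1 * b 2 - a 2 * b 1, a 2 * b 0 - a 0 * b 2, a 0 * b 1 - a 1 * b 0]

/-- The signed volume of the tetrahedron spanned by four points of `ℝ³`. -/
def signedVol (p1 p2 p3 p4 : E3) : ℝ :=
  -(1/6) * ⟪p1 - p4, cross3 (p2 - p4) (p3 - p4)⟫

/-- The affine map `x ↦ R·x + d` on `ℝ³`. -/
def rigid (R : Matrix (Fin 3) (Fin 3) ℝ) (d : E3) (x : E3) : E3 :=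
  (WithLp.equiv 2 (Fin 3 → ℝ)).symm (R.mulVec ((WithLp.equiv 2 (Fin 3 → ℝ)) x)) + d

theorem LinearMap.exists_linearIsometry_range_of_norm_eq {E F V : Type*} [NormedAddCommGroup E]
    [NormedSpace ℝ E] [NormedAddCommGroup F] [NormedSpace ℝ F] [AddCommGroup V] [Module ℝ V]
    (f : V →ₗ[ℝ] E) (g : V →ₗ[ℝ] F) (h : ∀ c, ‖f c‖ = ‖g c‖) :
    ∃ L : LinearMap.range f →ₗᵢ[ℝ] F, ∀ c, L ⟨f c, LinearMap.mem_range_self f c⟩ = g c := by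
  obtain ⟨s, hs⟩ := f.rangeRestrict.exists_rightInverse_of_surjective f.range_rangeRestrict
  have hfs : ∀ x, f (s x) = x := fun x ↦ congrArg Subtype.val (LinearMap.congr_fun hs x)
  refine ⟨⟨g ∘ₗ s, fun x ↦ ?_⟩, fun c ↦ ?_⟩
  · rw [LinearMap.comp_apply, ← h, hfs, Submodule.coe_norm]
  · change g (s _) = g c
    rw [← sub_eq_zero, ← map_sub, ← norm_eq_zero, ← h, map_sub, hfs, sub_self, norm_zero]

/-- Two finite families with the same Gram matrix are related by a linear isometry. -/
theorem exists_linearIsometryEquiv_of_inner_eq {E ι : Type*} [NormedAddCommGroup E]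
    [InnerProductSpace ℝ E] [FiniteDimensional ℝ E] [Fintype ι] (u v : ι → E)
    (h : ∀ i j, ⟪u i, u j⟫ = ⟪v i, v j⟫) : ∃ L : E ≃ₗᵢ[ℝ] E, ∀ i, L (u i) = v i := by
  classical
  have hnorm : ∀ c, ‖Fintype.linearCombination ℝ u c‖ = ‖Fintype.linearCombination ℝ v c‖ := by
    intro c
    rw [norm_eq_sqrt_real_inner, norm_eq_sqrt_real_inner]
    simp only [Fintype.linearCombination_apply, sum_inner, inner_sum, real_inner_smul_left,
      real_inner_smul_right, h]
  obtain ⟨L, hL⟩ := LinearMap.exists_linearIsometry_range_of_norm_eq _ _ hnorm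
  refine ⟨L.extend.toLinearIsometryEquiv rfl, fun i ↦ ?_⟩
  have hi := hL (Pi.single i 1)
  rw [← L.extend_apply] at hi
  simpa [Fintype.linearCombination_apply_single] using hi

theorem LinearIsometryEquiv.det_eq_one_or_neg_one {E : Type*} [NormedAddCommGroup E]
    [InnerProductSpace ℝ E] [FiniteDimensional ℝ E] (L : E ≃ₗᵢ[ℝ] E) :
    LinearMap.det (L.toLinearEquiv : E →ₗ[ℝ] E) = 1 ∨
      LinearMap.det (L.toLinearEquiv : E →ₗ[ℝ] E) = -1 := by
  have h := Matrix.det_of_mem_unitary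
    (L.toMatrix_mem_unitaryGroup (stdOrthonormalBasis ℝ E) (stdOrthonormalBasis ℝ E))
  have h' := (Unitary.mem_iff.mp h).1
  rw [star_trivial] at h'
  rw [← LinearMap.det_toMatrix (stdOrthonormalBasis ℝ E).toBasis]
  exact mul_self_eq_one_iff.mp h'

/-- A family that does not span is fixed by some orientation-reversing linear isometry. -/
theorem exists_linearIsometryEquiv_det_eq_neg_one_of_span_ne_top {E ι : Type*}
    [NormedAddCommGroup E] [InnerProductSpace ℝ E] [FiniteDimensional ℝ E] (u : ι → E)
    (h : Submodule.span ℝ (Set.range u) ≠ ⊤) :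
    ∃ L : E ≃ₗᵢ[ℝ] E, LinearMap.det (L.toLinearEquiv : E →ₗ[ℝ] E) = -1 ∧
      ∀ i, L (u i) = u i := by
  obtain ⟨w, hw, hw0⟩ := Submodule.exists_mem_ne_zero_of_ne_bot
    (mt Submodule.orthogonal_eq_bot_iff.mp h)
  refine ⟨(ℝ ∙ w)ᗮ.reflection, ?_, fun i ↦ ?_⟩
  · have h := (ℝ ∙ w)ᗮ.det_reflection
    rw [Submodule.orthogonal_orthogonal, finrank_span_singleton hw0, pow_one] at h
    exact h
  · rw [Submodule.reflection_eq_self_iff, Submodule.mem_orthogonal_singleton_iff_inner_left]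
    exact hw _ (Submodule.subset_span (Set.mem_range_self i))

theorem inner_cross3_eq_det (a b c : E3) :
    ⟪a, cross3 b c⟫ = (EuclideanSpace.basisFun (Fin 3) ℝ).toBasis.det ![a, b, c] := by
  rw [Module.Basis.det_apply, Matrix.det_fin_three]
  simp [cross3, PiLp.inner_apply, Fin.sum_univ_three, Module.Basis.toMatrix_apply]
  ring

theorem inner_map_cross3_map (f : E3 →ₗ[ℝ] E3) (a b c : E3) :
    ⟪f a, cross3 (f b) (f c)⟫ = LinearMap.det f * ⟪a, cross3 b c⟫ := by
  rw [inner_cross3_eq_det, inner_cross3_eq_det, ← Module.Basis.det_comp]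
  congr 1
  ext i
  fin_cases i <;> rfl

/-- Two triples of vectors with the same Gram matrix and the same triple product are related by a
rotation. -/
theorem exists_linearIsometryEquiv_det_eq_one (u v : Fin 3 → E3)
    (h : ∀ i j, ⟪u i, u j⟫ = ⟪v i, v j⟫)
    (hvol : ⟪u 0, cross3 (u 1) (u 2)⟫ = ⟪v 0, cross3 (v 1) (v 2)⟫) :
    ∃ L : E3 ≃ₗᵢ[ℝ] E3, LinearMap.det (L.toLinearEquiv : E3 →ₗ[ℝ] E3) = 1 ∧
      ∀ i, L (u i) = v i := by
  obtain ⟨L, hL⟩ := exists_linearIsometryEquiv_of_inner_eq u v h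
  rcases L.det_eq_one_or_neg_one with hdet | hdet
  · exact ⟨L, hdet, hL⟩
  have hspan : Submodule.span ℝ (Set.range u) ≠ ⊤ := by
    intro hs
    have hu : IsUnit ((EuclideanSpace.basisFun (Fin 3) ℝ).toBasis.det u) :=
      (Module.Basis.is_basis_iff_det _).mp
        ⟨linearIndependent_of_top_le_span_of_card_eq_finrank hs.ge (by simp), hs⟩
    have hu' : u = ![u 0, u 1, u 2] := by
      ext i
      fin_cases i <;> rfl
    rw [hu', ← inner_cross3_eq_det] at hu
    have hmap := inner_map_cross3_map (L.toLinearEquiv : E3 →ₗ[ℝ] E3) (u 0) (u 1) (u 2)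
    rw [hdet] at hmap
    simp only [LinearEquiv.coe_coe, LinearIsometryEquiv.coe_toLinearEquiv, hL] at hmap
    exact hu.ne_zero (by linarith)
  obtain ⟨S, hS, hSu⟩ := exists_linearIsometryEquiv_det_eq_neg_one_of_span_ne_top u hspan
  refine ⟨S.trans L, ?_, fun i ↦ by simp [hSu, hL]⟩
  have hcomp : ((S.trans L).toLinearEquiv : E3 →ₗ[ℝ] E3) =
      (L.toLinearEquiv : E3 →ₗ[ℝ] E3) ∘ₗ (S.toLinearEquiv : E3 →ₗ[ℝ] E3) := rfl
  rw [hcomp, LinearMap.det_comp, hdet, hS]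
  norm_num

theorem rigid_eq_toEuclideanLin_add (R : Matrix (Fin 3) (Fin 3) ℝ) (d x : E3) :
    rigid R d x = Matrix.toEuclideanLin R x + d := rfl

theorem rigid_sub_rigid (R : Matrix (Fin 3) (Fin 3) ℝ) (d x y : E3) :
    rigid R d x - rigid R d y = Matrix.toEuclideanLin R (x - y) := by
  rw [rigid_eq_toEuclideanLin_add, rigid_eq_toEuclideanLin_add, add_sub_add_right_eq_sub, map_sub]

theorem norm_toEuclideanLin_of_mem_orthogonalGroup {n : Type*} [Fintype n] [DecidableEq n]
    {R : Matrix n n ℝ} (hR : R ∈ Matrix.orthogonalGroup n ℝ) (x : EuclideanSpace ℝ n) :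
    ‖Matrix.toEuclideanLin R x‖ = ‖x‖ := by
  have hR' : R.transpose * R = 1 := Matrix.mem_unitaryGroup_iff'.mp hR
  rw [norm_eq_sqrt_real_inner, norm_eq_sqrt_real_inner]
  congr 1
  simp only [EuclideanSpace.inner_eq_star_dotProduct, star_trivial, Matrix.ofLp_toLpLin,
    Matrix.toLin'_apply]
  rw [Matrix.dotProduct_mulVec, ← Matrix.mulVec_transpose, Matrix.mulVec_mulVec, hR',
    Matrix.one_mulVec]

theorem det_toEuclideanLin {n : Type*} [Fintype n] [DecidableEq n] (R : Matrix n n ℝ) :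
    LinearMap.det (Matrix.toEuclideanLin R) = R.det := by
  rw [Matrix.toEuclideanLin_eq_toLin_orthonormal, LinearMap.det_toLin]

theorem exists_orthogonal_matrix_toEuclideanLin_eq {n : Type*} [Fintype n] [DecidableEq n]
    (L : EuclideanSpace ℝ n ≃ₗᵢ[ℝ] EuclideanSpace ℝ n) :
    ∃ R ∈ Matrix.orthogonalGroup n ℝ,
      Matrix.toEuclideanLin R = (L.toLinearEquiv : EuclideanSpace ℝ n →ₗ[ℝ] EuclideanSpace ℝ n) :=
  ⟨_, L.toMatrix_mem_unitaryGroup (EuclideanSpace.basisFun n ℝ) (EuclideanSpace.basisFun n ℝ), by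
    rw [Matrix.toEuclideanLin_eq_toLin_orthonormal, Matrix.toLin_toMatrix]⟩

theorem signedVol_rigid {R : Matrix (Fin 3) (Fin 3) ℝ} (hdet : R.det = 1) (d a b c e : E3) :
    signedVol (rigid R d a) (rigid R d b) (rigid R d c) (rigid R d e) = signedVol a b c e := by
  simp only [signedVol, rigid_sub_rigid, inner_map_cross3_map, det_toEuclideanLin, hdet, one_mul]

/-- Two labeled tetrahedra are strongly congruent (related by a direct
isometry) if and only if they are congruent (all pairwise distances equal) and have
equal signed volume. -/
theorem strongly_congruent_iff_congruent_and_signedVol_eq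
    (p1 p2 p3 p4 q1 q2 q3 q4 : E3) :
    (∃ R : Matrix (Fin 3) (Fin 3) ℝ, ∃ d : E3,
        R ∈ Matrix.orthogonalGroup (Fin 3) ℝ ∧ R.det = 1 ∧
        q1 = rigid R d p1 ∧ q2 = rigid R d p2 ∧ q3 = rigid R d p3 ∧ q4 = rigid R d p4) ↔
      ((∀ a b : Fin 4, ‖![p1, p2, p3, p4] a - ![p1, p2, p3, p4] b‖ =
          ‖![q1, q2, q3, q4] a - ![q1, q2, q3, q4] b‖) ∧
        signedVol p1 p2 p3 p4 = signedVol q1 q2 q3 q4) := by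
  constructor
  · rintro ⟨R, d, hR, hdet, rfl, rfl, rfl, rfl⟩
    refine ⟨fun a b ↦ ?_, (signedVol_rigid hdet d p1 p2 p3 p4).symm⟩
    have hq : ∀ i, ![rigid R d p1, rigid R d p2, rigid R d p3, rigid R d p4] i =
        rigid R d (![p1, p2, p3, p4] i) := by
      intro i
      fin_cases i <;> rfl
    rw [hq, hq, rigid_sub_rigid, norm_toEuclideanLin_of_mem_orthogonalGroup hR]
  · rintro ⟨hdist, hvol⟩
    have hinner : ∀ i j : Fin 4,
        ⟪![p1, p2, p3, p4] i - p4, ![p1, p2, p3, p4] j - p4⟫ =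
          ⟪![q1, q2, q3, q4] i - q4, ![q1, q2, q3, q4] j - q4⟫ := by
      intro i j
      have hi := hdist i 3
      have hj := hdist j 3
      have hij := hdist i j
      simp only [show ![p1, p2, p3, p4] 3 = p4 from rfl,
        show ![q1, q2, q3, q4] 3 = q4 from rfl] at hi hj
      rw [real_inner_eq_norm_mul_self_add_norm_mul_self_sub_norm_sub_mul_self_div_two,
        real_inner_eq_norm_mul_self_add_norm_mul_self_sub_norm_sub_mul_self_div_two,
        sub_sub_sub_cancel_right, sub_sub_sub_cancel_right, hi, hj, hij]
    obtain ⟨L, hL, hLp⟩ := exists_linearIsometryEquiv_det_eq_one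
      (fun i ↦ ![p1, p2, p3, p4] i.castSucc - p4) (fun i ↦ ![q1, q2, q3, q4] i.castSucc - q4)
      (fun i j ↦ hinner i.castSucc j.castSucc)
      (mul_left_cancel₀ (by norm_num) hvol)
    obtain ⟨R, hR, hRL⟩ := exists_orthogonal_matrix_toEuclideanLin_eq L
    have hrigid : ∀ p q : E3, L (p - p4) = q - q4 → q = rigid R (q4 - L p4) p := by
      intro p q hpq
      rw [rigid_eq_toEuclideanLin_add, hRL, LinearEquiv.coe_coe,
        LinearIsometryEquiv.coe_toLinearEquiv]
      rw [map_sub] at hpq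
      rw [add_sub_left_comm, hpq, add_sub_cancel]
    exact ⟨R, q4 - L p4, hR, by rw [← det_toEuclideanLin, hRL, hL], hrigid _ _ (hLp 0),
      hrigid _ _ (hLp 1), hrigid _ _ (hLp 2), hrigid _ _ (by simp)⟩
end
end

section
/- Under the two-agent closed loop the unit direction n2 is constant: let p1, p2 : ℝ → ℝ³ be differentiable with p21(t) := p1(t) − p2(t) ≠ 0 for all t, let d21, μ2 > 0, and suppose p1'(t) = 0 and p2'(t) = μ2·(‖p21(t)‖ − d21)·p21(t)/‖p21(t)‖ for all t. Then the unit vector n2(t) := p21(t)/‖p21(t)‖ has derivative zero, i.e., n2 is constant in t. -/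
open scoped RealInnerProductSpace
open Real Filter

noncomputable section

/-- The direction of a curve in an inner product space is stationary wherever the velocity is
parallel to the position. -/
theorem hasDerivAt_inv_norm_smul_of_deriv_parallel {E : Type*} [NormedAddCommGroup E]
    [InnerProductSpace ℝ E] {q : ℝ → E} {c t : ℝ} (hq : q t ≠ 0)
    (h : HasDerivAt q (c • q t) t) : HasDerivAt (fun s => ‖q s‖⁻¹ • q s) 0 t := by
  have hn : ‖q t‖ ≠ 0 := norm_ne_zero_iff.mpr hq
  have hnorm : HasDerivAt (fun s => ‖q s‖) (c * ‖q t‖) t := by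
    have hsqrt := h.norm_sq.sqrt (pow_ne_zero 2 hn)
    simp only [Real.sqrt_sq (norm_nonneg _), real_inner_smul_right,
      real_inner_self_eq_norm_sq] at hsqrt
    convert hsqrt using 1
    field_simp
  convert (hnorm.fun_inv hn).fun_smul h using 1
  rw [smul_smul, ← add_smul, eq_comm]
  convert zero_smul ℝ (q t) using 2
  field_simp
  ring

/-- Under the two-agent closed loop `p1' = 0`,
`p2' = μ2(‖p21‖ − d21)·p21/‖p21‖` (with `p21 := p1 − p2 ≠ 0`), the unit direction
`n2 := p21/‖p21‖` has derivative zero, i.e. is constant in time. -/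
theorem n2_constant_two_agent
    (p1 p2 : ℝ → E3) (d21 μ2 : ℝ) (hd : 0 < d21) (hμ : 0 < μ2)
    (hne : ∀ t : ℝ, p1 t - p2 t ≠ 0)
    (h1 : ∀ t : ℝ, HasDerivAt p1 0 t)
    (h2 : ∀ t : ℝ, HasDerivAt p2
      ((μ2 * (‖p1 t - p2 t‖ - d21) / ‖p1 t - p2 t‖) • (p1 t - p2 t)) t) :
    (∀ t : ℝ, HasDerivAt (fun s => ‖p1 s - p2 s‖⁻¹ • (p1 s - p2 s)) 0 t) ∧
      ∀ s t : ℝ, ‖p1 s - p2 s‖⁻¹ • (p1 s - p2 s) = ‖p1 t - p2 t‖⁻¹ • (p1 t - p2 t) := by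
  have hderiv : ∀ t : ℝ, HasDerivAt (fun s => ‖p1 s - p2 s‖⁻¹ • (p1 s - p2 s)) 0 t := by
    intro t
    refine hasDerivAt_inv_norm_smul_of_deriv_parallel (q := fun s => p1 s - p2 s)
      (c := -(μ2 * (‖p1 t - p2 t‖ - d21) / ‖p1 t - p2 t‖)) (hne t) ?_
    simpa only [zero_sub, neg_smul] using (h1 t).fun_sub (h2 t)
  exact ⟨hderiv, is_const_of_deriv_eq_zero (fun t => (hderiv t).differentiableAt)
    fun t => (hderiv t).deriv⟩
end
end

section
/- Under the three-agent closed loop the unit normal n123 is constant: let p1, p2, p3 : ℝ → ℝ³ be differentiable with p21(t) := p1(t) − p2(t), p31(t) := p1(t) − p3(t), p32(t) := p2(t) − p3(t), and suppose p31(t) × p32(t) ≠ 0 for all t. Define n123(t) := (p31(t) × p32(t))/‖p31(t) × p32(t)‖. Let d21, μ2, μ3, ν3 > 0 and desired values ζ3*, φ3* ∈ ℝ, and suppose p1' = 0, p2' = μ2·(‖p21‖ − d21)·p21/‖p21‖, and p3' = μ3·(⟨p31, p21⟩ − ζ3*)·p21 + ν3·(⟨p31, n123 × p21⟩ − φ3*)·(n123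 × p21) for all t. Then n123 has derivative zero, i.e., n123 is constant in t. -/
open scoped RealInnerProductSpace
open Real Filter

noncomputable section

theorem hasDerivAt_euclidean {ι : Type*} [Fintype ι] {f : ℝ → EuclideanSpace ℝ ι}
    {f' : EuclideanSpace ℝ ι} {t : ℝ} :
    HasDerivAt f f' t ↔ ∀ i, HasDerivAt (fun s => f s i) (f' i) t := by
  simp only [hasDerivAt_iff_hasFDerivAt, ← hasFDerivWithinAt_univ, hasFDerivWithinAt_euclidean]
  refine forall_congr' fun i => ?_
  congr! 1

theorem HasDerivAt.cross3 {a b : ℝ → E3} {a' b' : E3} {t : ℝ}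
    (ha : HasDerivAt a a' t) (hb : HasDerivAt b b' t) :
    HasDerivAt (fun s => cross3 (a s) (b s)) (cross3 a' (b t) + cross3 (a t) b') t := by
  rw [hasDerivAt_euclidean] at ha hb ⊢
  intro i
  fin_cases i
  · refine (((ha 1).mul (hb 2)).sub ((ha 2).mul (hb 1))).congr_deriv ?_
    simp [_root_.cross3]
    ring
  · refine (((ha 2).mul (hb 0)).sub ((ha 0).mul (hb 2))).congr_deriv ?_
    simp [_root_.cross3]
    ring
  · refine (((ha 0).mul (hb 1)).sub ((ha 1).mul (hb 0))).congr_deriv ?_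
    simp [_root_.cross3]
    ring

/-- Let `a` and `b` be two sides of a triangle, `e = a - b` the third and `w = a × b`. If the
common vertex of `a` and `b` has velocity `α e + β ((r w) × e)`, the far end of `a` is at rest and
the far end of `b` has velocity `k e`, then the velocity of `w` is a multiple of `w`. -/
theorem cross3_planar_velocity (a b : E3) (k α β r : ℝ) :
    cross3 (0 - (α • (a - b) + β • cross3 (r • cross3 a b) (a - b))) b +
      cross3 a (k • (a - b) - (α • (a - b) + β • cross3 (r • cross3 a b) (a - b))) =
    (-k - β * r * ((a 0 - b 0) ^ 2 + (a 1 - b 1) ^ 2 + (a 2 - b 2) ^ 2)) • cross3 a b := by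
  ext i
  fin_cases i <;> simp [cross3] <;> ring

/-- Normalizing a curve whose velocity is radial gives a curve with zero velocity. -/
theorem hasDerivAt_normalize_of_radial {E : Type*} [NormedAddCommGroup E]
    [InnerProductSpace ℝ E] {w : ℝ → E} {c t : ℝ} (hw : HasDerivAt w (c • w t) t)
    (h0 : w t ≠ 0) : HasDerivAt (fun s => ‖w s‖⁻¹ • w s) 0 t := by
  have hpos : ‖w t‖ ≠ 0 := norm_ne_zero_iff.mpr h0
  have hn : HasDerivAt (fun s => ‖w s‖) (c * ‖w t‖) t := by
    have h := hw.norm_sq.sqrt (pow_ne_zero 2 hpos)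
    simp only [Real.sqrt_sq (norm_nonneg _)] at h
    refine h.congr_deriv ?_
    rw [real_inner_smul_right, real_inner_self_eq_norm_sq]
    field_simp
  refine ((hn.inv hpos).smul hw).congr_deriv ?_
  rw [smul_smul, ← add_smul]
  convert zero_smul ℝ (w t)
  simp only [Pi.inv_apply]
  field_simp
  ring

/-- Under the three-agent closed loop, the unit normal
`n123 := (p31 × p32)/‖p31 × p32‖` has derivative zero, i.e. is constant in time. -/
theorem n123_constant_three_agent
    (p1 p2 p3 : ℝ → E3) (d21 μ2 μ3 ν3 ζs φs : ℝ)
    (hd : 0 < d21) (hμ2 : 0 < μ2) (hμ3 : 0 < μ3) (hν3 : 0 < ν3)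
    (hne : ∀ t : ℝ, cross3 (p1 t - p3 t) (p2 t - p3 t) ≠ 0)
    (h1 : ∀ t : ℝ, HasDerivAt p1 0 t)
    (h2 : ∀ t : ℝ, HasDerivAt p2
      ((μ2 * (‖p1 t - p2 t‖ - d21) / ‖p1 t - p2 t‖) • (p1 t - p2 t)) t)
    (h3 : ∀ t : ℝ, HasDerivAt p3
      ((μ3 * (⟪p1 t - p3 t, p1 t - p2 t⟫ - ζs)) • (p1 t - p2 t) +
        (ν3 * (⟪p1 t - p3 t,
            cross3 (‖cross3 (p1 t - p3 t) (p2 t - p3 t)‖⁻¹ •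
              cross3 (p1 t - p3 t) (p2 t - p3 t)) (p1 t - p2 t)⟫ - φs)) •
          cross3 (‖cross3 (p1 t - p3 t) (p2 t - p3 t)‖⁻¹ •
            cross3 (p1 t - p3 t) (p2 t - p3 t)) (p1 t - p2 t)) t) :
    (∀ t : ℝ, HasDerivAt
        (fun s => ‖cross3 (p1 s - p3 s) (p2 s - p3 s)‖⁻¹ •
          cross3 (p1 s - p3 s) (p2 s - p3 s)) 0 t) ∧
      ∀ s t : ℝ,
        ‖cross3 (p1 s - p3 s) (p2 s - p3 s)‖⁻¹ • cross3 (p1 s - p3 s) (p2 s - p3 s) =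
          ‖cross3 (p1 t - p3 t) (p2 t - p3 t)‖⁻¹ • cross3 (p1 t - p3 t) (p2 t - p3 t) := by
  have hderiv : ∀ t : ℝ, HasDerivAt
      (fun s => ‖cross3 (p1 s - p3 s) (p2 s - p3 s)‖⁻¹ •
        cross3 (p1 s - p3 s) (p2 s - p3 s)) 0 t := by
    intro t
    have hw := ((h1 t).sub (h3 t)).cross3 ((h2 t).sub (h3 t))
    simp only [Pi.sub_apply] at hw
    rw [← sub_sub_sub_cancel_right (p1 t) (p2 t) (p3 t), cross3_planar_velocity] at hw
    exact hasDerivAt_normalize_of_radial hw (hne t)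
  exact ⟨hderiv, is_const_of_deriv_eq_zero (fun t => (hderiv t).differentiableAt)
    fun t => (hderiv t).deriv⟩
end
end

section
/- Global exponential stability of the two-agent subsystem: let p1, p2 : ℝ → ℝ³ be differentiable with p21(t) := p1(t) − p2(t) ≠ 0 for all t ≥ 0, let d21, μ2 > 0, and suppose p1'(t) = 0 and p2'(t) = μ2·(‖p21(t)‖ − d21)·p21(t)/‖p21(t)‖ for all t ≥ 0. Then the distance error ζ̃2(t) := ‖p21(t)‖ − d21 satisfies ζ̃2'(t) = −μ2·ζ̃2(t), and hence ζ̃2(t) = ζ̃2(0)·exp(−μ2·t) for all t ≥ 0. -/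
open scoped RealInnerProductSpace
open Real Filter

noncomputable section

theorem HasDerivAt.norm_of_ne_zero {E : Type*} [NormedAddCommGroup E] [InnerProductSpace ℝ E]
    {f : ℝ → E} {f' : E} {t : ℝ} (hf : HasDerivAt f f' t) (h0 : f t ≠ 0) :
    HasDerivAt (fun s => ‖f s‖) (⟪f t, f'⟫ / ‖f t‖) t := by
  have h := hf.norm_sq.sqrt (pow_ne_zero 2 (norm_ne_zero_iff.mpr h0))
  simp only [Real.sqrt_sq (norm_nonneg _)] at h
  exact h.congr_deriv (mul_div_mul_left _ _ two_ne_zero)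

/-- A solution of `f' = c f` on `[0, ∞)` satisfies `f t * exp (-c t) = f 0`. -/
theorem mul_exp_neg_eq_of_hasDerivAt {f : ℝ → ℝ} {c t : ℝ} (ht : 0 ≤ t)
    (hf : ∀ s, 0 ≤ s → HasDerivAt f (c * f s) s) :
    f t * Real.exp (-(c * t)) = f 0 := by
  have hg : ∀ s, 0 ≤ s → HasDerivAt (fun s => f s * Real.exp (-(c * s))) 0 s := by
    intro s hs
    refine ((hf s hs).mul ((hasDerivAt_id s).const_mul c).neg.exp).congr_deriv ?_
    simp only [Pi.neg_apply, id]
    ring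
  have h := constant_of_has_deriv_right_zero (a := 0) (b := t)
    (fun s hs => (hg s hs.1).continuousAt.continuousWithinAt)
    (fun s hs => (hg s hs.1).hasDerivWithinAt) t ⟨ht, le_rfl⟩
  simpa using h

/-- Global exponential stability of the two-agent subsystem: under
`p1' = 0`, `p2' = μ2(‖p21‖ − d21)·p21/‖p21‖` for `t ≥ 0`, the distance error
`ζ̃2(t) = ‖p21(t)‖ − d21` satisfies `ζ̃2' = −μ2·ζ̃2`, hence
`ζ̃2(t) = ζ̃2(0)·exp(−μ2 t)` for all `t ≥ 0`. -/
theorem two_agent_GES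
    (p1 p2 : ℝ → E3) (d21 μ2 : ℝ) (hd : 0 < d21) (hμ : 0 < μ2)
    (hne : ∀ t : ℝ, 0 ≤ t → p1 t - p2 t ≠ 0)
    (h1 : ∀ t : ℝ, 0 ≤ t → HasDerivAt p1 0 t)
    (h2 : ∀ t : ℝ, 0 ≤ t → HasDerivAt p2
      ((μ2 * (‖p1 t - p2 t‖ - d21) / ‖p1 t - p2 t‖) • (p1 t - p2 t)) t) :
    (∀ t : ℝ, 0 ≤ t → HasDerivAt (fun s => ‖p1 s - p2 s‖ - d21)
        (-μ2 * (‖p1 t - p2 t‖ - d21)) t) ∧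
      ∀ t : ℝ, 0 ≤ t →
        ‖p1 t - p2 t‖ - d21 = (‖p1 0 - p2 0‖ - d21) * Real.exp (-μ2 * t) := by
  have hderiv : ∀ t : ℝ, 0 ≤ t → HasDerivAt (fun s => ‖p1 s - p2 s‖ - d21)
      (-μ2 * (‖p1 t - p2 t‖ - d21)) t := by
    intro t ht
    refine ((((h1 t ht).sub (h2 t ht)).norm_of_ne_zero (hne t ht)).sub_const d21).congr_deriv ?_
    have hn : ‖p1 t - p2 t‖ ≠ 0 := norm_ne_zero_iff.mpr (hne t ht)
    simp only [Pi.sub_apply, zero_sub, inner_neg_right, real_inner_smul_right,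
      real_inner_self_eq_norm_sq]
    field_simp
  refine ⟨hderiv, fun t ht => ?_⟩
  rw [← mul_exp_neg_eq_of_hasDerivAt ht hderiv, mul_assoc, ← Real.exp_add,
    neg_add_cancel, Real.exp_zero, mul_one]
end
end

section
/- Global exponential stability of the third agent's errors when the first two agents are at the desired distance and stationary: let p1, p2 ∈ ℝ³ be constant with ‖p21‖ = d21 > 0 where p21 := p1 − p2, and let p3 : ℝ → ℝ³ be differentiable with p31(t) := p1 − p3(t), p32(t) := p2 − p3(t), and p31(t) × p32(t) ≠ 0 for all t ≥ 0; set n123(t) := (p31(t) × p32(t))/‖p31(t) × p32(t)‖. Let μ3, ν3 > 0 and ζ3*, φ3* ∈ ℝ, define the errors ζ̃3 = ⟨p31, p21⟩ − ζ3* and φ̃3 = ⟨p31, n123 × p21⟩ − φ3*, and suppose p3' = μ3·ζ̃3·p21 + ν3·φ̃3·(n123 × p21) for all t ≥ 0. Then W3 := (1/2)ζ̃3² + (1/2)φ̃3² satisfies W3'(t) = −d21²·(μ3·ζ̃3(t)² + ν3·φ̃3(t)²); consequently W3(t) ≤ W3(0)·exp(−2·min(μ3, ν3)·d21²·t) for all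 t ≥ 0, so (ζ̃3, φ̃3) converges exponentially to (0,0). -/
open scoped RealInnerProductSpace
open Real Filter

noncomputable section

/-- Time-varying unit normal of the triangle `1-2-3` when agents 1 and 2 are fixed. -/
def n123f (p1 p2 : E3) (p3 : ℝ → E3) (t : ℝ) : E3 :=
  ‖cross3 (p1 - p3 t) (p2 - p3 t)‖⁻¹ • cross3 (p1 - p3 t) (p2 - p3 t)

/-- Projection error `ζ̃3 = ⟨p31, p21⟩ − ζ3*`. -/
def zeta3err (p1 p2 : E3) (p3 : ℝ → E3) (ζs t : ℝ) : ℝ :=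
  ⟪p1 - p3 t, p1 - p2⟫ - ζs

/-- Projection error `φ̃3 = ⟨p31, n123 × p21⟩ − φ3*`. -/
def phi3err (p1 p2 : E3) (p3 : ℝ → E3) (φs t : ℝ) : ℝ :=
  ⟪p1 - p3 t, cross3 (n123f p1 p2 p3 t) (p1 - p2)⟫ - φs

/-- Lyapunov function `W3 = (1/2)ζ̃3² + (1/2)φ̃3²`. -/
def W3 (p1 p2 : E3) (p3 : ℝ → E3) (ζs φs t : ℝ) : ℝ :=
  (1/2) * zeta3err p1 p2 p3 ζs t ^ 2 + (1/2) * phi3err p1 p2 p3 φs t ^ 2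

/-- The cross product with a fixed vector, as a continuous linear map. -/
def cross3CLM (e : E3) : E3 →L[ℝ] E3 :=
  LinearMap.toContinuousLinearMap
    { toFun := cross3 e
      map_add' := fun a b => by
        ext i; fin_cases i <;> simp [cross3] <;> ring
      map_smul' := fun c a => by
        ext i; fin_cases i <;> simp [cross3] <;> ring }

theorem cross3CLM_apply (e a : E3) : cross3CLM e a = cross3 e a := rfl

theorem cross3_sub_sub (p q r : E3) :
    cross3 (p - r) (q - r) = cross3 (p - q) (p - r) := by
  ext i; fin_cases i <;> simp [cross3] <;> ring

theorem cross3_self (e : E3) : cross3 e e = 0 := by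
  ext i; fin_cases i <;> simp [cross3] <;> ring

theorem inner_cross3_left_self (e n : E3) : ⟪cross3 n e, e⟫ = 0 := by
  simp [cross3, PiLp.inner_apply, Fin.sum_univ_three]; ring

/-- Cyclic invariance of the scalar triple product. -/
theorem inner_cross3_comm (a n e : E3) : ⟪a, cross3 n e⟫ = ⟪n, cross3 e a⟫ := by
  simp [cross3, PiLp.inner_apply, Fin.sum_univ_three]; ring

theorem inner_cross3_cross3 (e n : E3) (h : ⟪n, e⟫ = 0) :
    ⟪n, cross3 e (cross3 n e)⟫ = ‖e‖ ^ 2 * ‖n‖ ^ 2 := by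
  have key : ⟪n, cross3 e (cross3 n e)⟫ = ‖e‖ ^ 2 * ‖n‖ ^ 2 - ⟪n, e⟫ ^ 2 := by
    simp only [cross3, PiLp.inner_apply, Fin.sum_univ_three, EuclideanSpace.real_norm_sq_eq]
    simp; ring
  rw [key, h]; ring

theorem inner_smul_inv_norm_self (N : E3) : ⟪‖N‖⁻¹ • N, N⟫ = ‖N‖ := by
  rw [real_inner_smul_left, real_inner_self_eq_norm_sq]
  by_cases h : ‖N‖ = 0
  · simp [h]
  · field_simp

/-- The projection `⟨p31, n123 × p21⟩` is twice the area of the triangle. -/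
theorem phi3err_eq (p1 p2 : E3) (p3 : ℝ → E3) (φs t : ℝ) :
    phi3err p1 p2 p3 φs t = ‖cross3 (p1 - p2) (p1 - p3 t)‖ - φs := by
  rw [phi3err, n123f, inner_cross3_comm, cross3_sub_sub, inner_smul_inv_norm_self]

theorem inner_n123f (p1 p2 : E3) (p3 : ℝ → E3) (t : ℝ) :
    ⟪n123f p1 p2 p3 t, p1 - p2⟫ = 0 := by
  rw [n123f, cross3_sub_sub, real_inner_smul_left, real_inner_comm,
    inner_cross3_comm, inner_cross3_comm, cross3_self, inner_zero_right, mul_zero]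

theorem norm_n123f {p1 p2 : E3} {p3 : ℝ → E3} {t : ℝ}
    (h : cross3 (p1 - p3 t) (p2 - p3 t) ≠ 0) : ‖n123f p1 p2 p3 t‖ = 1 := by
  rw [n123f, norm_smul, norm_inv, norm_norm, inv_mul_cancel₀ (norm_ne_zero_iff.2 h)]

theorem HasDerivAt.norm_of_ne_zero_s13 {f : ℝ → E3} {f' : E3} {t : ℝ} (hf : HasDerivAt f f' t)
    (h : f t ≠ 0) : HasDerivAt (fun s => ‖f s‖) ⟪‖f t‖⁻¹ • f t, f'⟫ t := by
  have h0 := norm_ne_zero_iff.2 h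
  have := hf.norm_sq.sqrt (pow_ne_zero 2 h0)
  simp only [Real.sqrt_sq (norm_nonneg _)] at this
  refine this.congr_deriv ?_
  rw [real_inner_smul_left]
  field_simp

theorem hasDerivAt_zeta3err {p1 p2 : E3} {p3 : ℝ → E3} {ζs t a b : ℝ}
    (h : HasDerivAt p3 (a • (p1 - p2) + b • cross3 (n123f p1 p2 p3 t) (p1 - p2)) t) :
    HasDerivAt (zeta3err p1 p2 p3 ζs) (-(a * ‖p1 - p2‖ ^ 2)) t := by
  have := ((h.const_sub p1).inner ℝ (hasDerivAt_const t (p1 - p2))).sub_const ζs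
  refine this.congr_deriv ?_
  rw [inner_zero_right, inner_neg_left, inner_add_left, real_inner_smul_left,
    real_inner_smul_left, inner_cross3_left_self, real_inner_self_eq_norm_sq]
  ring

theorem hasDerivAt_phi3err {p1 p2 : E3} {p3 : ℝ → E3} {φs t a b : ℝ}
    (hne : cross3 (p1 - p3 t) (p2 - p3 t) ≠ 0)
    (h : HasDerivAt p3 (a • (p1 - p2) + b • cross3 (n123f p1 p2 p3 t) (p1 - p2)) t) :
    HasDerivAt (phi3err p1 p2 p3 φs) (-(b * ‖p1 - p2‖ ^ 2)) t := by
  have hN := (cross3CLM (p1 - p2)).hasFDerivAt.comp_hasDerivAt t (h.const_sub p1)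
  have hne' : cross3 (p1 - p2) (p1 - p3 t) ≠ 0 := cross3_sub_sub p1 p2 (p3 t) ▸ hne
  have := (hN.norm_of_ne_zero_s13 hne').sub_const φs
  rw [funext (phi3err_eq p1 p2 p3 φs)]
  refine this.congr_deriv ?_
  have hn : ‖(cross3CLM (p1 - p2) ∘ fun x => p1 - p3 x) t‖⁻¹ •
      (cross3CLM (p1 - p2) ∘ fun x => p1 - p3 x) t = n123f p1 p2 p3 t := by
    rw [n123f, cross3_sub_sub]; rfl
  rw [hn, map_neg, map_add, map_smul, map_smul]
  simp only [cross3CLM_apply]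
  rw [cross3_self, smul_zero, zero_add, inner_neg_right, real_inner_smul_right,
    inner_cross3_cross3 _ _ (inner_n123f p1 p2 p3 t), norm_n123f hne]
  ring

/-- Grönwall's inequality on `[0, ∞)` for a linear differential inequality. -/
theorem le_mul_exp_of_hasDerivAt_le {f f' : ℝ → ℝ} {c : ℝ}
    (hf : ∀ t, 0 ≤ t → HasDerivAt f (f' t) t) (hle : ∀ t, 0 ≤ t → f' t ≤ c * f t)
    {t : ℝ} (ht : 0 ≤ t) : f t ≤ f 0 * Real.exp (c * t) := by
  have hg : ∀ s, 0 ≤ s → HasDerivAt (fun s => f s * Real.exp (-(c * s)))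
      ((f' s - c * f s) * Real.exp (-(c * s))) s := fun s hs => by
    have := (hf s hs).mul (((hasDerivAt_id s).const_mul c).neg.exp)
    refine this.congr_deriv ?_
    simp only [id, Pi.neg_apply]
    ring
  have hanti : AntitoneOn (fun s => f s * Real.exp (-(c * s))) (Set.Ici 0) := by
    refine antitoneOn_of_hasDerivWithinAt_nonpos (convex_Ici 0)
      (fun s hs => (hg s hs).continuousAt.continuousWithinAt)
      (fun s hs => (hg s (interior_subset hs)).hasDerivWithinAt) fun s hs => ?_
    exact mul_nonpos_of_nonpos_of_nonneg
      (sub_nonpos.2 (hle s (interior_subset hs))) (Real.exp_pos _).le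
  have h0 := hanti Set.self_mem_Ici ht ht
  simp only [mul_zero, neg_zero, Real.exp_zero, mul_one] at h0
  rwa [Real.exp_neg, ← div_eq_mul_inv, div_le_iff₀ (Real.exp_pos _)] at h0

/-- Global exponential stability of the third agent's errors when the
first two agents are stationary at the desired distance: `W3' = −d21²(μ3 ζ̃3² + ν3 φ̃3²)`
and `W3(t) ≤ W3(0)·exp(−2 min(μ3,ν3) d21² t)` for all `t ≥ 0`. -/
theorem three_agent_GES
    (p1 p2 : E3) (p3 : ℝ → E3) (d21 μ3 ν3 ζs φs : ℝ)
    (hd : 0 < d21) (h21 : ‖p1 - p2‖ = d21) (hμ3 : 0 < μ3) (hν3 : 0 < ν3)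
    (hne : ∀ t : ℝ, 0 ≤ t → cross3 (p1 - p3 t) (p2 - p3 t) ≠ 0)
    (h3 : ∀ t : ℝ, 0 ≤ t → HasDerivAt p3
      ((μ3 * zeta3err p1 p2 p3 ζs t) • (p1 - p2) +
        (ν3 * phi3err p1 p2 p3 φs t) • cross3 (n123f p1 p2 p3 t) (p1 - p2)) t) :
    (∀ t : ℝ, 0 ≤ t → HasDerivAt (W3 p1 p2 p3 ζs φs)
        (-(d21 ^ 2) * (μ3 * zeta3err p1 p2 p3 ζs t ^ 2 +
          ν3 * phi3err p1 p2 p3 φs t ^ 2)) t) ∧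
      ∀ t : ℝ, 0 ≤ t →
        W3 p1 p2 p3 ζs φs t ≤
          W3 p1 p2 p3 ζs φs 0 * Real.exp (-2 * min μ3 ν3 * d21 ^ 2 * t) := by
  have hW : ∀ t : ℝ, 0 ≤ t → HasDerivAt (W3 p1 p2 p3 ζs φs)
      (-(d21 ^ 2) * (μ3 * zeta3err p1 p2 p3 ζs t ^ 2 +
        ν3 * phi3err p1 p2 p3 φs t ^ 2)) t := fun t ht => by
    have hζ := hasDerivAt_zeta3err (ζs := ζs) (h3 t ht)
    have hφ := hasDerivAt_phi3err (φs := φs) (hne t ht) (h3 t ht)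
    have := ((hζ.pow 2).const_mul (1 / 2)).add ((hφ.pow 2).const_mul (1 / 2))
    refine this.congr_deriv ?_
    rw [h21]
    push_cast
    ring
  refine ⟨hW, fun t ht => le_mul_exp_of_hasDerivAt_le hW (fun s _ => ?_) ht⟩
  have h1 := mul_le_mul_of_nonneg_right (min_le_left μ3 ν3) (sq_nonneg (zeta3err p1 p2 p3 ζs s))
  have h2 := mul_le_mul_of_nonneg_right (min_le_right μ3 ν3) (sq_nonneg (phi3err p1 p2 p3 φs s))
  have h := mul_le_mul_of_nonneg_left (add_le_add h1 h2) (sq_nonneg d21)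
  rw [W3]
  linarith
end
end

section
/- Mutual orthogonality of the zero-error planes: fix positive distances dji, dki, dkj, dli, dlj and place pi = (−dji/2, 0, 0), pj = (dji/2, 0, 0), pk = (xk, yk, 0) with yk > 0 so that ‖pki‖ = dki and ‖pkj‖ = dkj, where pab := pb − pa. Let n := pki × pkj (which is a nonzero multiple of (0,0,1)·(−dji·yk)) and fix desired values ζ*, φ*, ϑ* ∈ ℝ with ζ* = (dli² + dji² − dlj²)/2. For pl = (xl, yl, zl) ∈ ℝ³ define ζ̃ = ⟨pli, pji⟩ − ζ*, φ̃ = ⟨pli, n × pji⟩ − φ*, ϑ̃ = ⟨pli, n⟩ − ϑ*. Then: (1) ζ̃ = 0 if and only if xl = (dli² − dlj²)/(2·dji); (2) φ̃ = 0 if and only if yl = φ*/(dji·‖n‖); (3) ϑ̃ = 0 if and only if zl = −ϑ*/‖n‖. In particular, the three solution sets are affine planes whose normal vectors pji, n × pji, and n are mutually orthogonal. -/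
open scoped RealInnerProductSpace
open Real Filter

noncomputable section

/-- The point of `ℝ³` with coordinates `(a, b, c)`. -/
def vec3 (a b c : ℝ) : E3 := (WithLp.equiv 2 (Fin 3 → ℝ)).symm ![a, b, c]

theorem vec3_sub (a b c a' b' c' : ℝ) :
    vec3 a b c - vec3 a' b' c' = vec3 (a - a') (b - b') (c - c') := by
  ext i
  fin_cases i <;> simp [vec3]

theorem cross3_vec3 (a b c a' b' c' : ℝ) :
    cross3 (vec3 a b c) (vec3 a' b' c') =
      vec3 (b * c' - c * b') (c * a' - a * c') (a * b' - b * a') := by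
  simp [cross3, vec3]

theorem inner_vec3 (a b c a' b' c' : ℝ) :
    ⟪vec3 a b c, vec3 a' b' c'⟫ = a * a' + b * b' + c * c' := by
  simp [vec3, PiLp.inner_apply, Fin.sum_univ_three]
  ring

theorem norm_vec3_zero_zero {c : ℝ} (hc : 0 ≤ c) : ‖vec3 0 0 c‖ = c := by
  simp [vec3, EuclideanSpace.norm_eq, Fin.sum_univ_three, Real.sqrt_sq hc]

/-- Mutual orthogonality of the zero-error planes: with
`pi = (−dji/2,0,0)`, `pj = (dji/2,0,0)`, `pk = (xk,yk,0)` (`yk > 0`) at the desired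
distances, `n := pki × pkj`, and `ζ* = (dli² + dji² − dlj²)/2`, the solution sets
of `ζ̃ = 0`, `φ̃ = 0`, `ϑ̃ = 0` are the affine planes `xl = (dli² − dlj²)/(2dji)`,
`yl = φ*/(dji‖n‖)`, `zl = −ϑ*/‖n‖`, whose normals `pji`, `n × pji`, `n` are mutually
orthogonal. -/
theorem zero_error_planes
    (dji dki dkj dli dlj : ℝ)
    (hdji : 0 < dji) (hdki : 0 < dki) (hdkj : 0 < dkj) (hdli : 0 < dli) (hdlj : 0 < dlj)
    (xk yk : ℝ) (hyk : 0 < yk)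
    (φs ϑs : ℝ)
    (pi pj pk : E3)
    (hpi : pi = vec3 (-(dji/2)) 0 0)
    (hpj : pj = vec3 (dji/2) 0 0)
    (hpk : pk = vec3 xk yk 0)
    (hki : ‖pi - pk‖ = dki) (hkj : ‖pj - pk‖ = dkj) :
    (∀ xl yl zl : ℝ,
      (⟪pi - vec3 xl yl zl, pi - pj⟫ - (dli ^ 2 + dji ^ 2 - dlj ^ 2) / 2 = 0 ↔
          xl = (dli ^ 2 - dlj ^ 2) / (2 * dji)) ∧
      (⟪pi - vec3 xl yl zl, cross3 (cross3 (pi - pk) (pj - pk)) (pi - pj)⟫ - φs = 0 ↔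
          yl = φs / (dji * ‖cross3 (pi - pk) (pj - pk)‖)) ∧
      (⟪pi - vec3 xl yl zl, cross3 (pi - pk) (pj - pk)⟫ - ϑs = 0 ↔
          zl = -ϑs / ‖cross3 (pi - pk) (pj - pk)‖)) ∧
    ⟪pi - pj, cross3 (cross3 (pi - pk) (pj - pk)) (pi - pj)⟫ = 0 ∧
    ⟪pi - pj, cross3 (pi - pk) (pj - pk)⟫ = 0 ∧
    ⟪cross3 (pi - pk) (pj - pk), cross3 (cross3 (pi - pk) (pj - pk)) (pi - pj)⟫ = 0 := by
  have hn : cross3 (pi - pk) (pj - pk) = vec3 0 0 (dji * yk) := by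
    rw [hpi, hpj, hpk, vec3_sub, vec3_sub, cross3_vec3]
    congr 1 <;> ring
  have hji : pi - pj = vec3 (-dji) 0 0 := by
    rw [hpi, hpj, vec3_sub]
    congr 1 <;> ring
  have hN : 0 < dji * yk := mul_pos hdji hyk
  rw [hn, hji, hpi, norm_vec3_zero_zero hN.le, cross3_vec3]
  simp only [vec3_sub, inner_vec3]
  refine ⟨fun xl yl zl => ⟨?_, ?_, ?_⟩, by ring, by ring, by ring⟩
  · rw [eq_div_iff (by positivity)]
    constructor <;> intro h <;> linarith
  · rw [eq_div_iff (by positivity)]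
    constructor <;> intro h <;> linarith
  · rw [eq_div_iff (by positivity)]
    constructor <;> intro h <;> linarith
end
end

section
/- The projection variable φ4 depends only on inter-point distances: let p1, p2, p3, p4 ∈ ℝ³ with p31 × p32 ≠ 0, where pab := pb − pa, and set n123 := (p31 × p32)/‖p31 × p32‖ and φ4 := ⟨p41, n123 × p21⟩. Then φ4 = ⟨p32 × p12, p42 × p12⟩ / ‖p31 × p32‖ = [⟨p32, p42⟩·‖p12‖² − ⟨p32, p12⟩·⟨p12, p42⟩] / ‖p31 × p32‖. Consequently, if p̂1, p̂2, p̂3, p̂4 ∈ ℝ³ satisfy p̂31 × p̂32 ≠ 0 and ‖p̂a − p̂b‖ = ‖pa − pb‖ for all a, b ∈ {1,2,3,4}, then φ̂4 = φ4. -/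
open scoped RealInnerProductSpace
open Real Filter

noncomputable section

/-- The Binet–Cauchy identity. -/
theorem inner_cross3_cross3_s16 (a b c d : E3) :
    ⟪cross3 a b, cross3 c d⟫ = ⟪a, c⟫ * ⟪b, d⟫ - ⟪a, d⟫ * ⟪b, c⟫ := by
  simp only [cross3, PiLp.inner_apply, Fin.sum_univ_three]
  simp
  ring

/-- Twice the area vector of a triangle does not depend on the chosen base vertex. -/
theorem cross3_sub_base (p1 p2 p3 : E3) :
    cross3 (p1 - p3) (p2 - p3) = cross3 (p2 - p3) (p2 - p1) := by
  ext i
  fin_cases i <;> simp [cross3] <;> ring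

theorem inner_cross3_smul_sub (r : ℝ) (n p1 p2 p4 : E3) :
    ⟪p1 - p4, cross3 (r • n) (p1 - p2)⟫ = r * ⟪n, cross3 (p2 - p4) (p2 - p1)⟫ := by
  simp only [cross3, PiLp.inner_apply, Fin.sum_univ_three]
  simp
  ring

theorem inner_cross3_normalize_eq_gram_div (p1 p2 p3 p4 : E3) :
    ⟪p1 - p4, cross3 (‖cross3 (p1 - p3) (p2 - p3)‖⁻¹ • cross3 (p1 - p3) (p2 - p3))
        (p1 - p2)⟫ =
      (⟪p2 - p3, p2 - p4⟫ * ‖p2 - p1‖ ^ 2 - ⟪p2 - p3, p2 - p1⟫ * ⟪p2 - p1, p2 - p4⟫) /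
        ‖cross3 (p1 - p3) (p2 - p3)‖ := by
  rw [inner_cross3_smul_sub, cross3_sub_base, inner_cross3_cross3_s16,
    real_inner_self_eq_norm_sq, inv_mul_eq_div]

theorem inner_sub_sub_eq_norm (x y z : E3) :
    ⟪x - y, x - z⟫ = (‖x - y‖ ^ 2 + ‖x - z‖ ^ 2 - ‖y - z‖ ^ 2) / 2 := by
  have h := norm_sub_sq_real (x - y) (x - z)
  rw [sub_sub_sub_cancel_left, norm_sub_rev z y] at h
  linarith

theorem norm_cross3 (a b : E3) :
    ‖cross3 a b‖ = √(‖a‖ ^ 2 * ‖b‖ ^ 2 - ⟪a, b⟫ ^ 2) := by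
  rw [norm_eq_sqrt_real_inner, inner_cross3_cross3_s16, real_inner_self_eq_norm_sq,
    real_inner_self_eq_norm_sq, real_inner_comm a b, sq ⟪a, b⟫]

/-- The projection variable `φ4 = ⟨p41, n123 × p21⟩` depends only on
the inter-point distances:
`φ4 = ⟨p32 × p12, p42 × p12⟩/‖p31 × p32‖
    = (⟨p32,p42⟩‖p12‖² − ⟨p32,p12⟩⟨p12,p42⟩)/‖p31 × p32‖`, and consequently any other
quadruple with the same pairwise distances (and nondegenerate triangle `1-2-3`) has the
same `φ4`. -/
theorem phi4_distance_invariant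
    (p1 p2 p3 p4 q1 q2 q3 q4 : E3)
    (hp : cross3 (p1 - p3) (p2 - p3) ≠ 0)
    (hq : cross3 (q1 - q3) (q2 - q3) ≠ 0)
    (hdist : ∀ a b : Fin 4,
      ‖![q1, q2, q3, q4] a - ![q1, q2, q3, q4] b‖ =
        ‖![p1, p2, p3, p4] a - ![p1, p2, p3, p4] b‖) :
    ⟪p1 - p4, cross3 (‖cross3 (p1 - p3) (p2 - p3)‖⁻¹ • cross3 (p1 - p3) (p2 - p3))
        (p1 - p2)⟫ =
      ⟪cross3 (p2 - p3) (p2 - p1), cross3 (p2 - p4) (p2 - p1)⟫ /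
        ‖cross3 (p1 - p3) (p2 - p3)‖ ∧
    ⟪p1 - p4, cross3 (‖cross3 (p1 - p3) (p2 - p3)‖⁻¹ • cross3 (p1 - p3) (p2 - p3))
        (p1 - p2)⟫ =
      (⟪p2 - p3, p2 - p4⟫ * ‖p2 - p1‖ ^ 2 - ⟪p2 - p3, p2 - p1⟫ * ⟪p2 - p1, p2 - p4⟫) /
        ‖cross3 (p1 - p3) (p2 - p3)‖ ∧
    ⟪q1 - q4, cross3 (‖cross3 (q1 - q3) (q2 - q3)‖⁻¹ • cross3 (q1 - q3) (q2 - q3))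
        (q1 - q2)⟫ =
      ⟪p1 - p4, cross3 (‖cross3 (p1 - p3) (p2 - p3)‖⁻¹ • cross3 (p1 - p3) (p2 - p3))
        (p1 - p2)⟫ := by
  refine ⟨?_, inner_cross3_normalize_eq_gram_div p1 p2 p3 p4, ?_⟩
  · rw [inner_cross3_smul_sub, cross3_sub_base, inv_mul_eq_div]
  · have h21 : ‖q2 - q1‖ = ‖p2 - p1‖ := hdist 1 0
    have h23 : ‖q2 - q3‖ = ‖p2 - p3‖ := hdist 1 2
    have h24 : ‖q2 - q4‖ = ‖p2 - p4‖ := hdist 1 3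
    have h31 : ‖q3 - q1‖ = ‖p3 - p1‖ := hdist 2 0
    have h34 : ‖q3 - q4‖ = ‖p3 - p4‖ := hdist 2 3
    have h14 : ‖q1 - q4‖ = ‖p1 - p4‖ := hdist 0 3
    rw [inner_cross3_normalize_eq_gram_div, inner_cross3_normalize_eq_gram_div,
      cross3_sub_base p1, cross3_sub_base q1]
    simp only [norm_cross3, inner_sub_sub_eq_norm, h21, h23, h24, h31, h34, h14]
end
end
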